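/- Let ε ∈ (0, 1/2), let m ≥ 2 be an integer, and let f : ℝ → ℝ be measurable with f ∈ L¹(ℝ) and ∫_ℝ∫_ℝ |f(u)f(v)| |u−v|^{2ε−1} du dv < ∞. Then ∫_{ℝ^m} |f(u₁)⋯f(u_m)| · |u₁−u₂|^{ε−1/2} |u₂−u₃|^{ε−1/2} ⋯ |u_{m−1}−u_m|^{ε−1/2} |u_m−u₁|^{ε−1/2} du₁⋯du_m < ∞. -/

import Mathlib

open MeasureTheory ENNReal Set

/-- Cauchy–Schwarz inequality for lower Lebesgue integrals, in squared form. -/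
theorem lintegral_mul_sq_le {α : Type*} [MeasurableSpace α] {μ : Measure α} {g h : α → ℝ≥0∞}
    (hg : AEMeasurable g μ) (hh : AEMeasurable h μ) :
    (∫⁻ x, g x * h x ∂μ) ^ 2 ≤ (∫⁻ x, g x ^ 2 ∂μ) * ∫⁻ x, h x ^ 2 ∂μ := by
  have holder := ENNReal.lintegral_mul_le_Lp_mul_Lq μ Real.HolderConjugate.two_two hg hh
  have sq_half (a : ℝ≥0∞) : (a ^ (1 / 2 : ℝ)) ^ 2 = a := by
    rw [← ENNReal.rpow_natCast, ← ENNReal.rpow_mul]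
    norm_num
  simp only [Pi.mul_apply, ENNReal.rpow_two] at holder
  calc (∫⁻ x, g x * h x ∂μ) ^ 2
      ≤ ((∫⁻ x, g x ^ 2 ∂μ) ^ (1 / 2 : ℝ) * (∫⁻ x, h x ^ 2 ∂μ) ^ (1 / 2 : ℝ)) ^ 2 := by
        gcongr
    _ = _ := by rw [mul_pow, sq_half, sq_half]

/-- Composition of kernels is submultiplicative for the Hilbert–Schmidt norm. -/
theorem lintegral_sq_lintegral_mul_le {α : Type*} [MeasurableSpace α] {μ : Measure α} [SFinite μ]
    {G K : α → α → ℝ≥0∞} (hG : Measurable fun p : α × α => G p.1 p.2)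
    (hK : Measurable fun p : α × α => K p.1 p.2) :
    ∫⁻ x, ∫⁻ y, (∫⁻ t, G x t * K t y ∂μ) ^ 2 ∂μ ∂μ ≤
      (∫⁻ x, ∫⁻ t, G x t ^ 2 ∂μ ∂μ) * ∫⁻ t, ∫⁻ y, K t y ^ 2 ∂μ ∂μ := by
  have hG' : Measurable fun x => ∫⁻ t, G x t ^ 2 ∂μ := (hG.pow_const 2).lintegral_prod_right'
  have hK' : Measurable fun y => ∫⁻ t, K t y ^ 2 ∂μ := (hK.pow_const 2).lintegral_prod_left'
  calc ∫⁻ x, ∫⁻ y, (∫⁻ t, G x t * K t y ∂μ) ^ 2 ∂μ ∂μ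
      ≤ ∫⁻ x, ∫⁻ y, (∫⁻ t, G x t ^ 2 ∂μ) * ∫⁻ t, K t y ^ 2 ∂μ ∂μ ∂μ := by
        gcongr with x y
        exact lintegral_mul_sq_le (hG.comp measurable_prodMk_left).aemeasurable
          (hK.comp measurable_prodMk_right).aemeasurable
    _ = (∫⁻ x, ∫⁻ t, G x t ^ 2 ∂μ ∂μ) * ∫⁻ y, ∫⁻ t, K t y ^ 2 ∂μ ∂μ := by
        simp_rw [lintegral_const_mul _ hK']
        rw [lintegral_mul_const _ hG']
    _ = _ := by
        rw [lintegral_lintegral_swap (f := fun y t => K t y ^ 2)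
          ((hK.comp measurable_swap).pow_const 2).aemeasurable]

/-- The lower Lebesgue integral over a finite power, with the first coordinate integrated first. -/
theorem lintegral_pi_fin_succ {α : Type*} [MeasurableSpace α] {μ : Measure α} [SigmaFinite μ]
    {n : ℕ} {F : (Fin (n + 1) → α) → ℝ≥0∞} (hF : Measurable F) :
    ∫⁻ u, F u ∂Measure.pi (fun _ => μ) =
      ∫⁻ v, ∫⁻ t, F (Fin.cons t v) ∂μ ∂Measure.pi (fun _ : Fin n => μ) := by
  have e := (measurePreserving_piFinSuccAbove (fun _ : Fin (n + 1) => μ) 0).symm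
  rw [← e.lintegral_comp hF]
  refine (lintegral_prod_symm' _ (hF.comp e.measurable)).trans ?_
  simp [MeasurableEquiv.piFinSuccAbove, Fin.insertNthEquiv]

/-- A cyclic integral of square-integrable kernels, all equal except for one, is finite. -/
theorem lintegral_prod_mul_lt_top {α : Type*} [MeasurableSpace α] {μ : Measure α} [SigmaFinite μ]
    {K : α → α → ℝ≥0∞} (hK : Measurable fun p : α × α => K p.1 p.2)
    (hK2 : ∫⁻ x, ∫⁻ y, K x y ^ 2 ∂μ ∂μ < ⊤) (n : ℕ)
    {G : α → α → ℝ≥0∞} (hG : Measurable fun p : α × α => G p.1 p.2)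
    (hG2 : ∫⁻ x, ∫⁻ y, G x y ^ 2 ∂μ ∂μ < ⊤) :
    ∫⁻ u : Fin (n + 2) → α, (∏ i : Fin (n + 1), K (u i.castSucc) (u i.succ)) *
      G (u (Fin.last (n + 1))) (u 0) ∂Measure.pi (fun _ => μ) < ⊤ := by
  have hmeas {n : ℕ} {G : α → α → ℝ≥0∞} (hG : Measurable fun p : α × α => G p.1 p.2) :
      Measurable fun u : Fin (n + 2) → α => (∏ i : Fin (n + 1), K (u i.castSucc) (u i.succ)) *
        G (u (Fin.last (n + 1))) (u 0) := by
    refine (Finset.measurable_fun_prod _ fun i _ => ?_).mul ?_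
    · exact hK.comp (f := fun u : Fin (n + 2) → α => (u i.castSucc, u i.succ)) (by fun_prop)
    · exact hG.comp (f := fun u : Fin (n + 2) → α => (u (Fin.last (n + 1)), u 0)) (by fun_prop)
  have hcomp {H : α → α → ℝ≥0∞} (hH : Measurable fun p : α × α => H p.1 p.2) :
      Measurable fun p : α × α => ∫⁻ t, H p.1 t * K t p.2 ∂μ := by
    refine Measurable.lintegral_prod_right'
      (f := fun q : (α × α) × α => H q.1.1 q.2 * K q.2 q.1.2) ?_
    exact (hH.comp ((measurable_fst.comp measurable_fst).prodMk measurable_snd)).mul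
      (hK.comp (measurable_snd.prodMk (measurable_snd.comp measurable_fst)))
  induction n generalizing G with
  | zero =>
    have key : ∫⁻ x, ∫⁻ t, G x t * K t x ∂μ ∂μ < ⊤ := by
      have hK' : Measurable fun p : α × α => K p.2 p.1 := hK.comp measurable_swap
      calc ∫⁻ x, ∫⁻ t, G x t * K t x ∂μ ∂μ
          ≤ ∫⁻ x, ∫⁻ t, (G x t ^ 2 + K t x ^ 2) ∂μ ∂μ := by
            gcongr with x t
            rcases le_total (G x t) (K t x) with h | h
            · calc G x t * K t x ≤ K t x * K t x := by gcongr
                _ = K t x ^ 2 := (sq _).symm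
                _ ≤ _ := le_add_self
            · calc G x t * K t x ≤ G x t * G x t := by gcongr
                _ = G x t ^ 2 := (sq _).symm
                _ ≤ _ := le_self_add
        _ = (∫⁻ x, ∫⁻ t, G x t ^ 2 ∂μ ∂μ) + ∫⁻ x, ∫⁻ t, K t x ^ 2 ∂μ ∂μ := by
            rw [← lintegral_add_left (hG.pow_const 2).lintegral_prod_right']
            refine lintegral_congr fun x => ?_
            exact lintegral_add_left ((hG.comp measurable_prodMk_left).pow_const 2) _
        _ < ⊤ := by
            rw [lintegral_lintegral_swap (f := fun x t => K t x ^ 2) (hK'.pow_const 2).aemeasurable]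
            exact ENNReal.add_lt_top.2 ⟨hG2, hK2⟩
    rw [lintegral_pi_fin_succ (hmeas hG)]
    have h0 : Measurable fun x => ∫⁻ t, G x t * K t x ∂μ :=
      (hcomp hG).comp (measurable_id.prodMk measurable_id)
    rw [← (measurePreserving_funUnique μ (Fin 1)).lintegral_comp h0] at key
    convert key using 3 with v
    refine lintegral_congr fun t => ?_
    simpa using mul_comm _ _
  | succ n ih =>
    rw [lintegral_pi_fin_succ (hmeas hG)]
    have hG' := (lintegral_sq_lintegral_mul_le hG hK).trans_lt (ENNReal.mul_lt_top hG2 hK2)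
    convert ih (hcomp hG) hG' using 3 with v
    rw [← lintegral_const_mul _ ?_]
    · refine lintegral_congr fun t => ?_
      rw [Fin.prod_univ_succ]
      simp only [Fin.castSucc_zero, Fin.cons_zero, Fin.cons_succ, ← Fin.succ_castSucc,
        ← Fin.succ_last]
      ring
    · exact (hG.comp measurable_prodMk_left).mul (hK.comp measurable_prodMk_right)

/-- The cyclic integral of a square-integrable kernel is finite. -/
theorem lintegral_cyclic_prod_lt_top {α : Type*} [MeasurableSpace α] {μ : Measure α}
    [SigmaFinite μ] {K : α → α → ℝ≥0∞} (hK : Measurable fun p : α × α => K p.1 p.2)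
    (hK2 : ∫⁻ x, ∫⁻ y, K x y ^ 2 ∂μ ∂μ < ⊤) {m : ℕ} [NeZero m] (hm : 2 ≤ m) :
    ∫⁻ u : Fin m → α, ∏ i : Fin m, K (u i) (u (i + 1)) ∂Measure.pi (fun _ => μ) < ⊤ := by
  obtain ⟨n, rfl⟩ := Nat.exists_eq_add_of_le' hm
  convert lintegral_prod_mul_lt_top hK hK2 n hK hK2 using 3 with u
  rw [Fin.prod_univ_castSucc]
  simp [Fin.coeSucc_eq_succ, Fin.last_add_one]

/-- For `ε ∈ (0, 1/2)`, `m ≥ 2`, and measurable `f : ℝ → ℝ` with `f ∈ L¹(ℝ)` and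
`∫∫ |f(u)f(v)| |u−v|^{2ε−1} du dv < ∞`, the `m`-fold cyclic integral
`∫_{ℝ^m} |f(u₁)⋯f(u_m)| ∏ |u_i − u_{i+1}|^{ε−1/2} du` (cyclically) is finite. -/
theorem cyclic_dominating_integral_finite
    (ε : ℝ) (hε : ε ∈ Set.Ioo (0 : ℝ) (1 / 2))
    (m : ℕ) [NeZero m] (hm : 2 ≤ m)
    (f : ℝ → ℝ) (hf : Measurable f) (hf1 : Integrable f)
    (hf2 : (∫⁻ p : ℝ × ℝ,
        ENNReal.ofReal (|f p.1 * f p.2| * |p.1 - p.2| ^ (2 * ε - 1))) < ⊤) :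
    (∫⁻ u : Fin m → ℝ,
        ENNReal.ofReal
          (|∏ i : Fin m, f (u i)| *
            ∏ i : Fin m, |u i - u (i + 1)| ^ (ε - 1 / 2))) < ⊤ := by
  let K : ℝ → ℝ → ℝ≥0∞ := fun x y =>
    ENNReal.ofReal (√|f x| * √|f y| * |x - y| ^ (ε - 1 / 2))
  have hK : Measurable fun p : ℝ × ℝ => K p.1 p.2 := by
    simp only [K]
    fun_prop
  have hsq (x y : ℝ) : K x y ^ 2 = ENNReal.ofReal (|f x * f y| * |x - y| ^ (2 * ε - 1)) := by
    simp only [K]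
    rw [← ENNReal.ofReal_pow (by positivity), mul_pow, mul_pow, Real.sq_sqrt (abs_nonneg _),
      Real.sq_sqrt (abs_nonneg _), abs_mul, ← Real.rpow_mul_natCast (abs_nonneg _)]
    congr 3
    push_cast
    ring
  have hK2 : ∫⁻ x, ∫⁻ y, K x y ^ 2 < ⊤ := by
    rw [← lintegral_prod (fun p : ℝ × ℝ => K p.1 p.2 ^ 2) (hK.pow_const 2).aemeasurable]
    simp only [hsq]
    exact hf2
  have hcyc := lintegral_cyclic_prod_lt_top hK hK2 hm
  refine (lintegral_congr fun u => ?_).trans_lt hcyc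
  simp only [K]
  have hshift : ∏ i, √|f (u (i + 1))| = ∏ i, √|f (u i)| :=
    Equiv.prod_comp (Equiv.addRight (1 : Fin m)) fun i => √|f (u i)|
  rw [← ENNReal.ofReal_prod_of_nonneg fun i _ => by positivity, Finset.prod_mul_distrib,
    Finset.prod_mul_distrib, hshift, ← Finset.prod_mul_distrib, Finset.abs_prod]
  simp only [Real.mul_self_sqrt (abs_nonneg _)]
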